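/- arXiv:1905.11031 — 8 statements merged into one kernel-verified Lean document; each statement's English description precedes it below -/
import Mathlib

section
/- Let (u_t)_{t≥0} be a sequence of nonnegative real numbers and let C ≥ 0 be a constant such that (u_{t+1})² ≤ C·(u_t − u_{t+1}) for every t ≥ 0. Then for every t ≥ 1 it holds that u_t ≤ max(2C, √(C·u_0)) / t. -/
/-- Lemma 1: if a nonnegative sequence satisfies `(u_{t+1})² ≤ C (u_t − u_{t+1})`,
then `u_t ≤ max(2C, √(C u_0)) / t` for all `t ≥ 1`. -/
theorem recursive_sequence_bound (u : ℕ → ℝ) (C : ℝ) (hC : 0 ≤ C)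
    (hu : ∀ t, 0 ≤ u t)
    (hrec : ∀ t, (u (t + 1)) ^ 2 ≤ C * (u t - u (t + 1))) :
    ∀ t : ℕ, 1 ≤ t → u t ≤ max (2 * C) (Real.sqrt (C * u 0)) / t := by
  have hM : 2 * C ≤ max (2 * C) (Real.sqrt (C * u 0)) := le_max_left _ _
  have hM' : Real.sqrt (C * u 0) ≤ max (2 * C) (Real.sqrt (C * u 0)) := le_max_right _ _
  generalize max (2 * C) (Real.sqrt (C * u 0)) = M at hM hM' ⊢
  intro t ht
  induction t, ht using Nat.le_induction with
  | base =>
    have h : u 1 ≤ Real.sqrt (C * u 0) :=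
      Real.le_sqrt_of_sq_le (by nlinarith [hrec 0, mul_nonneg hC (hu 1)])
    simpa using h.trans hM'
  | succ t ht ih =>
    have ht' : (1 : ℝ) ≤ t := by exact_mod_cast ht
    rw [le_div_iff₀ (by positivity)] at ih ⊢
    push_cast
    by_contra! hlt
    have hr := hrec t
    have hx := hu (t + 1)
    generalize u (t + 1) = x at hlt hr hx
    have hpos : 0 < x := by
      refine lt_of_le_of_ne hx fun h => ?_
      rw [← h] at hlt
      linarith
    have hmul : t * x * x ≤ C * x := by
      have h₁ : t * x ^ 2 ≤ t * (C * (u t - x)) := by gcongr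
      have h₂ : C * (u t * t) ≤ C * (x * (t + 1)) :=
        mul_le_mul_of_nonneg_left (ih.trans hlt.le) hC
      linarith
    have hle : t * x ≤ C := le_of_mul_le_mul_right hmul hpos
    nlinarith
end

section
/- Let f : ℝⁿ → ℝ be convex and differentiable, let L > 0, and let s ≥ 1 be an integer. Suppose x̄ ∈ ℝⁿ satisfies ‖x̄‖₀ ≤ s and x̄ is an L-stationary point, i.e., x̄ is a global minimizer of the map y ↦ f(x̄) + ⟨∇f(x̄), y − x̄⟩ + (L/2)‖y − x̄‖₂² over the set {y ∈ ℝⁿ : ‖y‖₀ ≤ s}. Then x̄ is a basic stationary point: x̄ is a global minimizer of f over the set {y ∈ ℝⁿ : y_i = 0 for every index i with x̄_i = 0}. -/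
open scoped RealInnerProductSpace

open Classical in
/-- Number of nonzero components of a vector (the ℓ₀ pseudo-norm). -/
noncomputable def norm0 {n : ℕ} (x : EuclideanSpace ℝ (Fin n)) : ℕ :=
  (Finset.univ.filter fun i => x i ≠ 0).card

/-- First-order lower bound for a convex function with a gradient. -/
theorem ConvexOn.inner_gradient_le_sub {E : Type*} [NormedAddCommGroup E] [InnerProductSpace ℝ E]
    [CompleteSpace E] {f : E → ℝ} {g x : E} (hf : ConvexOn ℝ Set.univ f)
    (hg : HasGradientAt f g x) (y : E) : ⟪g, y - x⟫ ≤ f y - f x := by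
  have hconv : ConvexOn ℝ Set.univ (f ∘ AffineMap.lineMap (k := ℝ) x y) := by
    simpa using hf.comp_affineMap (AffineMap.lineMap (k := ℝ) x y)
  have hderiv : HasDerivAt (f ∘ AffineMap.lineMap (k := ℝ) x y) ⟪g, y - x⟫ 0 := by
    have hg' : HasFDerivAt f (InnerProductSpace.toDual ℝ E g) (AffineMap.lineMap x y (0 : ℝ)) := by
      simpa using hg.hasFDerivAt
    simpa using hg'.comp_hasDerivAt (0 : ℝ) AffineMap.hasDerivAt_lineMap
  simpa [slope_def_field] using
    hconv.le_slope_of_hasDerivAt (Set.mem_univ 0) (Set.mem_univ 1) zero_lt_one hderiv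

theorem norm0_le_norm0 {n : ℕ} {x y : EuclideanSpace ℝ (Fin n)} (h : ∀ i, x i = 0 → y i = 0) :
    norm0 y ≤ norm0 x := by
  classical
  refine Finset.card_le_card fun i hi => ?_
  simp only [Finset.mem_filter, Finset.mem_univ, true_and] at hi ⊢
  exact mt (h i) hi

theorem nonneg_of_forall_pos_mul_add_sq_mul_nonneg {a b : ℝ} (hb : 0 ≤ b)
    (h : ∀ t : ℝ, 0 < t → 0 ≤ t * a + t ^ 2 * b) : 0 ≤ a := by
  by_contra! ha
  have ht : 0 < -a / (b + 1) := div_pos (by linarith) (by linarith)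
  have hfactor : -a / (b + 1) * a + (-a / (b + 1)) ^ 2 * b = -(a / (b + 1)) ^ 2 := by
    field_simp
    ring
  have hpos : 0 < (a / (b + 1)) ^ 2 := by
    have : a / (b + 1) ≠ 0 := div_ne_zero ha.ne (by linarith)
    positivity
  linarith [h _ ht]

/-- Proposition 1(a), sparsity-constrained case: an `L`-stationary point of
`min f(x) s.t. ‖x‖₀ ≤ s` is a basic stationary point. -/
theorem Lstat_imp_basic_cons {n : ℕ} (f : EuclideanSpace ℝ (Fin n) → ℝ)
    (f' : EuclideanSpace ℝ (Fin n) → EuclideanSpace ℝ (Fin n))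
    (hconv : ConvexOn ℝ Set.univ f)
    (hgrad : ∀ y, HasGradientAt f (f' y) y)
    (L : ℝ) (hL : 0 < L) (s : ℕ) (hs : 1 ≤ s)
    (xb : EuclideanSpace ℝ (Fin n)) (hxb : norm0 xb ≤ s)
    (hLstat : ∀ y : EuclideanSpace ℝ (Fin n), norm0 y ≤ s →
      f xb ≤ f xb + ⟪f' xb, y - xb⟫ + L / 2 * ‖y - xb‖ ^ 2) :
    ∀ y : EuclideanSpace ℝ (Fin n), (∀ i, xb i = 0 → y i = 0) → f xb ≤ f y := by
  intro y hy
  have hinner : 0 ≤ ⟪f' xb, y - xb⟫ := by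
    refine nonneg_of_forall_pos_mul_add_sq_mul_nonneg (b := L / 2 * ‖y - xb‖ ^ 2)
      (by positivity) fun t _ => ?_
    have hsupp : norm0 (xb + t • (y - xb)) ≤ s :=
      (norm0_le_norm0 fun i hi => by simp [hi, hy i hi]).trans hxb
    have hstat := hLstat _ hsupp
    rw [add_sub_cancel_left, inner_smul_right, norm_smul, mul_pow, Real.norm_eq_abs, sq_abs]
      at hstat
    linarith
  linarith [hconv.inner_gradient_le_sub (hgrad xb) y]
end

section
/- Let f : ℝⁿ → ℝ be convex and differentiable, and let L > 0 and λ > 0. Suppose x̄ ∈ ℝⁿ is an L-stationary point of the sparse regularized problem, i.e., x̄ is a global minimizer of the map y ↦ f(x̄) + ⟨∇f(x̄), y − x̄⟩ + (L/2)‖y − x̄‖₂² + λ‖y‖₀ over ℝⁿ. Then: (i) for every index j with x̄_j ≠ 0, (∇f(x̄))_j = 0 and |x̄_j| ≥ √(2λ/L); (ii) for every index i with x̄_i = 0, |(∇f(x̄))_i| ≤ √(2λL); and (iii) x̄ is a basic stationary point: x̄ is a global minimizer of f over the set {y ∈ ℝⁿ : y_i = 0 for every index i with x̄_i = 0}. 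-/
open scoped RealInnerProductSpace

/-- Changing a nonzero coordinate does not increase the number of nonzero components. -/
theorem norm0_add_single_le {n : ℕ} (x : EuclideanSpace ℝ (Fin n)) (i : Fin n) (t : ℝ)
    (hi : x i ≠ 0) : norm0 (x + EuclideanSpace.single i t) ≤ norm0 x := by
  classical
  unfold norm0
  refine Finset.card_le_card fun k hk => ?_
  rw [Finset.mem_filter] at hk ⊢
  refine ⟨hk.1, ?_⟩
  by_cases h : k = i
  · rwa [h]
  · simpa [h] using hk.2

/-- Changing one coordinate increases the number of nonzero components by at most one. -/
theorem norm0_add_single_le_add_one {n : ℕ} (x : EuclideanSpace ℝ (Fin n)) (i : Fin n) (t : ℝ) :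
    norm0 (x + EuclideanSpace.single i t) ≤ norm0 x + 1 := by
  classical
  unfold norm0
  refine le_trans (Finset.card_le_card (t := insert i (Finset.univ.filter fun k => x k ≠ 0))
    fun k hk => ?_) (Finset.card_insert_le _ _)
  rw [Finset.mem_filter] at hk
  rw [Finset.mem_insert, Finset.mem_filter]
  by_cases h : k = i
  · exact Or.inl h
  · exact Or.inr ⟨hk.1, by simpa [h] using hk.2⟩

/-- Setting a nonzero coordinate to zero decreases the number of nonzero components. -/
theorem norm0_add_single_neg_lt {n : ℕ} (x : EuclideanSpace ℝ (Fin n)) (i : Fin n)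
    (hi : x i ≠ 0) : norm0 (x + EuclideanSpace.single i (-x i)) < norm0 x := by
  classical
  unfold norm0
  refine Finset.card_lt_card (Finset.ssubset_iff_of_subset (fun k hk => ?_) |>.2
    ⟨i, by simpa using hi, by simp⟩)
  rw [Finset.mem_filter] at hk ⊢
  refine ⟨hk.1, ?_⟩
  by_cases h : k = i
  · rwa [h]
  · simpa [h] using hk.2

/-- The gradient inequality for convex functions. -/
theorem ConvexOn.add_inner_gradient_le {E : Type*} [NormedAddCommGroup E] [InnerProductSpace ℝ E]
    [CompleteSpace E] {f : E → ℝ} {g x : E} (hf : ConvexOn ℝ Set.univ f)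
    (hg : HasGradientAt f g x) (y : E) : f x + ⟪g, y - x⟫ ≤ f y := by
  have hconv : ConvexOn ℝ Set.univ (f ∘ AffineMap.lineMap (k := ℝ) x y) := by
    simpa using hf.comp_affineMap (AffineMap.lineMap (k := ℝ) x y)
  have hderiv : HasDerivAt (f ∘ AffineMap.lineMap (k := ℝ) x y) ⟪g, y - x⟫ 0 := by
    have h : HasFDerivAt f (InnerProductSpace.toDual ℝ E g)
        (AffineMap.lineMap (k := ℝ) x y 0) := by
      simpa using hg.hasFDerivAt
    simpa using h.comp_hasDerivAt (0 : ℝ) AffineMap.hasDerivAt_lineMap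
  have h := hconv.le_slope_of_hasDerivAt (Set.mem_univ 0) (Set.mem_univ 1) one_pos hderiv
  simp only [slope_def_field, Function.comp_apply, AffineMap.lineMap_apply_one,
    AffineMap.lineMap_apply_zero, sub_zero, div_one] at h
  linarith

/-- Proposition 1(a), sparse regularized case: an `L`-stationary point of
`min f(x) + λ‖x‖₀` satisfies the stated support conditions and is a basic
stationary point. -/
theorem Lstat_imp_basic_regu {n : ℕ} (f : EuclideanSpace ℝ (Fin n) → ℝ)
    (f' : EuclideanSpace ℝ (Fin n) → EuclideanSpace ℝ (Fin n))
    (hconv : ConvexOn ℝ Set.univ f)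
    (hgrad : ∀ y, HasGradientAt f (f' y) y)
    (L lam : ℝ) (hL : 0 < L) (hlam : 0 < lam)
    (xb : EuclideanSpace ℝ (Fin n))
    (hLstat : ∀ y : EuclideanSpace ℝ (Fin n),
      f xb + lam * norm0 xb ≤
        f xb + ⟪f' xb, y - xb⟫ + L / 2 * ‖y - xb‖ ^ 2 + lam * norm0 y) :
    (∀ j, xb j ≠ 0 → f' xb j = 0 ∧ Real.sqrt (2 * lam / L) ≤ |xb j|) ∧
    (∀ i, xb i = 0 → |f' xb i| ≤ Real.sqrt (2 * lam * L)) ∧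
    (∀ y : EuclideanSpace ℝ (Fin n), (∀ i, xb i = 0 → y i = 0) → f xb ≤ f y) := by
  have hstep (i : Fin n) (t : ℝ) : lam * norm0 xb ≤
      t * f' xb i + L / 2 * t ^ 2 + lam * norm0 (xb + EuclideanSpace.single i t) := by
    have h := hLstat (xb + EuclideanSpace.single i t)
    rw [add_sub_cancel_left, EuclideanSpace.inner_single_right, PiLp.norm_single,
      Real.norm_eq_abs, sq_abs] at h
    simp only [conj_trivial] at h
    linarith
  have hmin (g : ℝ) : -g / L * g + L / 2 * (-g / L) ^ 2 = -(g ^ 2 / (2 * L)) := by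
    field_simp
    ring
  have hzero (j : Fin n) (hj : xb j ≠ 0) : f' xb j = 0 := by
    have h := hstep j (-f' xb j / L)
    have hcard : (norm0 (xb + EuclideanSpace.single j (-f' xb j / L)) : ℝ) ≤ norm0 xb :=
      mod_cast norm0_add_single_le xb j _ hj
    have hlc := mul_le_mul_of_nonneg_left hcard hlam.le
    rw [hmin] at h
    have hg : f' xb j ^ 2 / (2 * L) ≤ 0 := by linarith
    rw [div_le_iff₀ (by positivity), zero_mul] at hg
    exact pow_eq_zero_iff two_ne_zero |>.1 (le_antisymm hg (sq_nonneg _))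
  refine ⟨fun j hj => ⟨hzero j hj, ?_⟩, fun i _ => ?_, fun y hy => ?_⟩
  · have h := hstep j (-xb j)
    have hcard : (norm0 (xb + EuclideanSpace.single j (-xb j)) : ℝ) + 1 ≤ norm0 xb :=
      mod_cast norm0_add_single_neg_lt xb j hj
    have hlc := mul_le_mul_of_nonneg_left hcard hlam.le
    rw [hzero j hj] at h
    refine Real.sqrt_le_iff.2 ⟨abs_nonneg _, ?_⟩
    rw [sq_abs, div_le_iff₀ hL]
    linarith
  · have h := hstep i (-f' xb i / L)
    have hcard : (norm0 (xb + EuclideanSpace.single i (-f' xb i / L)) : ℝ) ≤ norm0 xb + 1 :=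
      mod_cast norm0_add_single_le_add_one xb i _
    have hlc := mul_le_mul_of_nonneg_left hcard hlam.le
    rw [hmin] at h
    have hg : f' xb i ^ 2 / (2 * L) ≤ lam := by linarith
    rw [div_le_iff₀ (by positivity)] at hg
    refine Real.abs_le_sqrt ?_
    linarith
  · have hinner : ⟪f' xb, y - xb⟫ = 0 := by
      rw [PiLp.inner_apply]
      refine Finset.sum_eq_zero fun i _ => ?_
      by_cases hi : xb i = 0
      · simp [hi, hy i hi]
      · simp [hzero i hi]
    have h := hconv.add_inner_gradient_le (hgrad xb) y
    rwa [hinner, add_zero] at h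
end

section
/- Let f : ℝⁿ → ℝ be convex and differentiable with L-Lipschitz continuous gradient (L > 0), and let λ > 0. Define F(x) = f(x) + λ‖x‖₀. Suppose x̄ ∈ ℝⁿ is a block-1 stationary point: for every coordinate index i and every t ∈ ℝ, F(x̄) ≤ F(x̄ + t·e_i). Then x̄ is an L-stationary point: x̄ is a global minimizer of the map y ↦ f(x̄) + ⟨∇f(x̄), y − x̄⟩ + (L/2)‖y − x̄‖₂² + λ‖y‖₀ over ℝⁿ. -/
open scoped RealInnerProductSpace

/-- Descent lemma: a function with `L`-Lipschitz gradient lies below its quadratic upper model. -/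
lemma le_quadratic_of_lipschitz_gradient {E : Type*} [NormedAddCommGroup E]
    [InnerProductSpace ℝ E] [CompleteSpace E] {f : E → ℝ} {f' : E → E}
    (hgrad : ∀ y, HasGradientAt f (f' y) y) {L : ℝ} (hL : 0 ≤ L)
    (hlip : LipschitzWith (Real.toNNReal L) f') (x v : E) :
    f (x + v) ≤ f x + ⟪f' x, v⟫ + L / 2 * ‖v‖ ^ 2 := by
  have hline (t : ℝ) : HasDerivAt (fun s : ℝ => f (x + s • v)) ⟪f' (x + t • v), v⟫ t := by
    have h1 : HasDerivAt (fun s : ℝ => x + s • v) v t := by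
      simpa using ((hasDerivAt_id t).smul_const v).const_add x
    exact ((hgrad (x + t • v)).hasFDerivAt.comp_hasDerivAt t h1).congr_deriv
      (InnerProductSpace.toDual_apply_apply ..)
  have hbound (t : ℝ) (ht : 0 ≤ t) :
      ⟪f' (x + t • v), v⟫ ≤ ⟪f' x, v⟫ + L * t * ‖v‖ ^ 2 := by
    have h1 : ‖f' (x + t • v) - f' x‖ ≤ L * (t * ‖v‖) := by
      simpa [dist_eq_norm, norm_smul, abs_of_nonneg ht, Real.coe_toNNReal L hL]
        using hlip.dist_le_mul (x + t • v) x
    have h2 := real_inner_le_norm (f' (x + t • v) - f' x) v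
    rw [inner_sub_left] at h2
    nlinarith [mul_le_mul_of_nonneg_right h1 (norm_nonneg v)]
  have hmodel (t : ℝ) : HasDerivAt
      (fun s : ℝ => f x + s * ⟪f' x, v⟫ + L / 2 * ‖v‖ ^ 2 * s ^ 2)
      (⟪f' x, v⟫ + L * t * ‖v‖ ^ 2) t := by
    refine ((((hasDerivAt_id t).mul_const ⟪f' x, v⟫).const_add (f x)).add
      ((hasDerivAt_pow 2 t).const_mul (L / 2 * ‖v‖ ^ 2))).congr_deriv ?_
    norm_num
    ring
  have h := image_le_of_deriv_right_le_deriv_boundary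
    (a := (0 : ℝ)) (b := 1)
    (fun t _ => (hline t).continuousAt.continuousWithinAt)
    (fun t _ => (hline t).hasDerivWithinAt)
    (by simp)
    (fun t _ => (hmodel t).continuousAt.continuousWithinAt)
    (fun t _ => (hmodel t).hasDerivWithinAt)
    (fun t ht => hbound t ht.1) (x := 1) (by simp)
  simpa using h

open Classical in
lemma norm0_eq_sum {n : ℕ} (x : EuclideanSpace ℝ (Fin n)) :
    (norm0 x : ℝ) = ∑ i, if x i ≠ 0 then (1 : ℝ) else 0 := by
  rw [Finset.sum_boole, norm0]

open Classical in
/-- Changing the `i`-th coordinate only affects the `i`-th contribution to `norm0`. -/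
lemma norm0_add_single {n : ℕ} (x : EuclideanSpace ℝ (Fin n)) (i : Fin n) (d : ℝ) :
    (norm0 (x + d • EuclideanSpace.single i (1 : ℝ)) : ℝ) + (if x i ≠ 0 then (1 : ℝ) else 0)
      = norm0 x + if x i + d ≠ 0 then (1 : ℝ) else 0 := by
  rw [norm0_eq_sum, norm0_eq_sum, ← Finset.add_sum_erase _ _ (Finset.mem_univ i),
    ← Finset.add_sum_erase _ (fun j => if x j ≠ 0 then (1 : ℝ) else 0)
      (Finset.mem_univ i)]
  have h : ∑ j ∈ Finset.univ.erase i,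
        (if (x + d • EuclideanSpace.single i (1 : ℝ)) j ≠ 0 then (1 : ℝ) else 0)
      = ∑ j ∈ Finset.univ.erase i, if x j ≠ 0 then (1 : ℝ) else 0 :=
    Finset.sum_congr rfl fun j hj => by simp [Finset.ne_of_mem_erase hj]
  have hi : (x + d • EuclideanSpace.single i (1 : ℝ)) i = x i + d := by simp
  rw [h, hi]
  ring

/-- Proposition 1(b), sparse regularized case: a block-1 stationary point of
`F(x) = f(x) + λ‖x‖₀` is an `L`-stationary point. -/
theorem block1_imp_Lstat_regu {n : ℕ} (f : EuclideanSpace ℝ (Fin n) → ℝ)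
    (f' : EuclideanSpace ℝ (Fin n) → EuclideanSpace ℝ (Fin n))
    (hconv : ConvexOn ℝ Set.univ f)
    (hgrad : ∀ y, HasGradientAt f (f' y) y)
    (L lam : ℝ) (hL : 0 < L) (hlam : 0 < lam)
    (hlip : LipschitzWith (Real.toNNReal L) f')
    (F : EuclideanSpace ℝ (Fin n) → ℝ)
    (hF : ∀ x, F x = f x + lam * norm0 x)
    (xb : EuclideanSpace ℝ (Fin n))
    (hblock : ∀ (i : Fin n) (t : ℝ), F xb ≤ F (xb + t • EuclideanSpace.single i (1 : ℝ))) :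
    ∀ y : EuclideanSpace ℝ (Fin n),
      f xb + lam * norm0 xb ≤
        f xb + ⟪f' xb, y - xb⟫ + L / 2 * ‖y - xb‖ ^ 2 + lam * norm0 y := by
  classical
  intro y
  have hcoord (i : Fin n) : lam * (if xb i ≠ 0 then (1 : ℝ) else 0) ≤
      f' xb i * (y i - xb i) + L / 2 * (y i - xb i) ^ 2
        + lam * (if y i ≠ 0 then (1 : ℝ) else 0) := by
    have h1 := hblock i (y i - xb i)
    have h2 := le_quadratic_of_lipschitz_gradient hgrad hL.le hlip xb
      ((y i - xb i) • EuclideanSpace.single i (1 : ℝ))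
    have h3 := norm0_add_single xb i (y i - xb i)
    have h4 : ⟪f' xb, (y i - xb i) • EuclideanSpace.single i (1 : ℝ)⟫
        = f' xb i * (y i - xb i) := by
      simp [inner_smul_right, EuclideanSpace.inner_single_right, mul_comm]
    have h5 : ‖(y i - xb i) • EuclideanSpace.single i (1 : ℝ)‖ ^ 2 = (y i - xb i) ^ 2 := by
      simp [norm_smul]
    rw [hF, hF] at h1
    rw [h4, h5] at h2
    rw [add_sub_cancel] at h3
    have h6 := congrArg (lam * ·) h3
    simp only [mul_add] at h6
    linarith
  have hinner : ⟪f' xb, y - xb⟫ = ∑ i, f' xb i * (y i - xb i) := by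
    simp [PiLp.inner_apply, mul_comm]
  have hnorm : ‖y - xb‖ ^ 2 = ∑ i, (y i - xb i) ^ 2 := by
    simp [EuclideanSpace.norm_sq_eq]
  have hsum := Finset.sum_le_sum fun i (_ : i ∈ Finset.univ) => hcoord i
  rw [Finset.sum_add_distrib, Finset.sum_add_distrib, ← Finset.mul_sum, ← Finset.mul_sum,
    ← Finset.mul_sum, ← norm0_eq_sum, ← norm0_eq_sum, ← hinner, ← hnorm] at hsum
  linarith
end

section
/- Let f : ℝⁿ → ℝ be differentiable, let θ > 0, let s ≥ 1 be an integer, let x ∈ ℝⁿ, and let B ⊆ {1,…,n} be an index set. Suppose x⁺ is a global minimizer of the map z ↦ f(z) + (θ/2)‖z − x‖₂² over the set {z ∈ ℝⁿ : z_i = x_i for every i ∉ B, and ‖z‖₀ ≤ s}. Then for every index i ∈ B with x⁺_i ≠ 0, the i-th partial derivative satisfies (∇f(x⁺))_i + θ(x⁺_i − x_i) = 0. -/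
/-- Moving along a coordinate axis on which `x` is already nonzero does not enlarge the support. -/
theorem norm0_add_smul_single_le {n : ℕ} (x : EuclideanSpace ℝ (Fin n)) {i : Fin n}
    (hi : x i ≠ 0) (t : ℝ) :
    norm0 (x + t • EuclideanSpace.single i (1 : ℝ)) ≤ norm0 x := by
  unfold norm0
  refine Finset.card_le_card fun j hj => ?_
  simp only [Finset.mem_filter, Finset.mem_univ, true_and] at hj ⊢
  intro hxj
  have hji : j ≠ i := fun h => hi (h ▸ hxj)
  exact hj (by simp [hxj, hji])

/-- First-order optimality condition (eq. (4)) on the nonzero support of the solution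
of the proximal block subproblem for the sparsity-constrained problem. -/
theorem subproblem_optimality_cons {n : ℕ} (f : EuclideanSpace ℝ (Fin n) → ℝ)
    (f' : EuclideanSpace ℝ (Fin n) → EuclideanSpace ℝ (Fin n))
    (hgrad : ∀ y, HasGradientAt f (f' y) y)
    (θ : ℝ) (hθ : 0 < θ) (s : ℕ) (hs : 1 ≤ s)
    (x xp : EuclideanSpace ℝ (Fin n)) (B : Finset (Fin n))
    (hfeas : ∀ i ∉ B, xp i = x i) (hsp : norm0 xp ≤ s)
    (hmin : ∀ z : EuclideanSpace ℝ (Fin n), (∀ i ∉ B, z i = x i) → norm0 z ≤ s →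
      f xp + θ / 2 * ‖xp - x‖ ^ 2 ≤ f z + θ / 2 * ‖z - x‖ ^ 2) :
    ∀ i ∈ B, xp i ≠ 0 → f' xp i + θ * (xp i - x i) = 0 := by
  intro i hi hne
  set e : EuclideanSpace ℝ (Fin n) := EuclideanSpace.single i (1 : ℝ) with he
  have hline : HasDerivAt (fun t : ℝ => xp + t • e) e 0 := by
    simpa using ((hasDerivAt_id (0 : ℝ)).smul_const e).const_add xp
  have hf : HasDerivAt (fun t : ℝ => f (xp + t • e)) (f' xp i) 0 := by
    have h := (hgrad (xp + (0 : ℝ) • e)).hasFDerivAt.comp_hasDerivAt (0 : ℝ) hline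
    simpa [he, Function.comp_def, EuclideanSpace.inner_single_right] using h
  have hq : HasDerivAt (fun t : ℝ => θ / 2 * ‖xp + t • e - x‖ ^ 2) (θ * (xp i - x i)) 0 := by
    have h := ((hline.sub_const x).norm_sq).const_mul (θ / 2)
    refine h.congr_deriv ?_
    simp [he, EuclideanSpace.inner_single_right]
    ring
  have hlocal : IsLocalMin (fun t : ℝ => f (xp + t • e) + θ / 2 * ‖xp + t • e - x‖ ^ 2) 0 := by
    refine Filter.Eventually.of_forall fun t => ?_
    have h := hmin (xp + t • e) (fun j hj => ?_) ((norm0_add_smul_single_le xp hne t).trans hsp)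
    · simpa using h
    · have hji : j ≠ i := fun h => hj (h ▸ hi)
      simp [he, hji, hfeas j hj]
  exact hlocal.hasDerivAt_eq_zero (hf.add hq)
end

section
/- Let f : ℝⁿ → ℝ be convex and differentiable, let θ > 0, and let x, x̄ ∈ ℝⁿ. Suppose x⁺ is a global minimizer of the map z ↦ f(z) + (θ/2)‖z − x‖₂² over ℝⁿ. Then f(x⁺) − f(x̄) ≤ θ·‖x⁺ − x‖₂·‖x⁺ − x̄‖₂. -/
/-- The variational inequality of the proximal point step: no differentiability is needed. -/
theorem ConvexOn.sub_le_inner_of_forall_prox_le {E : Type*} [NormedAddCommGroup E]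
    [InnerProductSpace ℝ E] {f : E → ℝ} (hf : ConvexOn ℝ Set.univ f) {θ : ℝ} (hθ : 0 ≤ θ)
    {x p : E} (hp : ∀ z, f p + θ / 2 * ‖p - x‖ ^ 2 ≤ f z + θ / 2 * ‖z - x‖ ^ 2) (y : E) :
    f p - f y ≤ θ * inner ℝ (p - x) (y - p) := by
  have key : ∀ t : ℝ, 0 < t → t ≤ 1 →
      f p - f y ≤ θ * inner ℝ (p - x) (y - p) + t * (θ / 2 * ‖y - p‖ ^ 2) := by
    intro t ht ht1
    have hc : f ((1 - t) • p + t • y) ≤ (1 - t) * f p + t * f y :=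
      hf.2 (Set.mem_univ p) (Set.mem_univ y) (by linarith) ht.le (by ring)
    have hz : (1 - t) • p + t • y - x = (p - x) + t • (y - p) := by module
    have hm := hp ((1 - t) • p + t • y)
    rw [hz, norm_add_sq_real, inner_smul_right, norm_smul, mul_pow, Real.norm_eq_abs,
      sq_abs] at hm
    refine le_of_mul_le_mul_left ?_ ht
    linarith
  by_contra! hlt
  set K := θ / 2 * ‖y - p‖ ^ 2
  have hK : 0 ≤ K := by positivity
  set d := f p - f y - θ * inner ℝ (p - x) (y - p) with hd
  have hd0 : 0 < d := by linarith
  have h := key (d / (d + K)) (by positivity) ((div_le_one (by positivity)).2 (by linarith))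
  have hlt_d : d / (d + K) * K < d := by
    rw [div_mul_eq_mul_div, div_lt_iff₀ (by positivity)]
    nlinarith
  linarith

/-- Cost-to-go bound for the proximal point step (inequalities (12), full-dimensional
case): if `x⁺` globally minimizes `z ↦ f z + (θ/2)‖z − x‖²`, then
`f(x⁺) − f(x̄) ≤ θ ‖x⁺ − x‖ ‖x⁺ − x̄‖`. -/
theorem prox_cost_to_go {n : ℕ} (f : EuclideanSpace ℝ (Fin n) → ℝ)
    (hconv : ConvexOn ℝ Set.univ f) (hdiff : Differentiable ℝ f)
    (θ : ℝ) (hθ : 0 < θ) (x xb xp : EuclideanSpace ℝ (Fin n))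
    (hmin : ∀ z : EuclideanSpace ℝ (Fin n),
      f xp + θ / 2 * ‖xp - x‖ ^ 2 ≤ f z + θ / 2 * ‖z - x‖ ^ 2) :
    f xp - f xb ≤ θ * ‖xp - x‖ * ‖xp - xb‖ := by
  have h := hconv.sub_le_inner_of_forall_prox_le hθ.le hmin xb
  calc f xp - f xb ≤ θ * inner ℝ (xp - x) (xb - xp) := h
    _ ≤ θ * (‖xp - x‖ * ‖xb - xp‖) := by gcongr; exact real_inner_le_norm _ _
    _ = θ * ‖xp - x‖ * ‖xp - xb‖ := by rw [norm_sub_rev xb xp, mul_assoc]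
end

section
/- Let σ > 0 and let f : ℝⁿ → ℝ be differentiable and σ-strongly convex, with global minimizer x̄. Let θ > 0 and x ∈ ℝⁿ, and suppose x⁺ is a global minimizer of the map z ↦ f(z) + (θ/2)‖z − x‖₂² over ℝⁿ. Then f(x⁺) − f(x̄) ≤ α·(f(x) − f(x̄)), where α = (θ/σ)/(1 + θ/σ). -/
/-- One-step contraction of the proximal point step for `σ`-strongly convex objectives
(inequalities (13), full-dimensional case): if `x̄` is the global minimizer of `f` and
`x⁺` globally minimizes `z ↦ f z + (θ/2)‖z − x‖²`, then
`f(x⁺) − f(x̄) ≤ α (f(x) − f(x̄))` with `α = (θ/σ)/(1 + θ/σ)`. -/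
theorem prox_contraction {n : ℕ} (σ : ℝ) (hσ : 0 < σ)
    (f : EuclideanSpace ℝ (Fin n) → ℝ) (hdiff : Differentiable ℝ f)
    (hsconv : ConvexOn ℝ Set.univ (fun y => f y - σ / 2 * ‖y‖ ^ 2))
    (xb : EuclideanSpace ℝ (Fin n)) (hxb : ∀ y, f xb ≤ f y)
    (θ : ℝ) (hθ : 0 < θ) (x xp : EuclideanSpace ℝ (Fin n))
    (hmin : ∀ z : EuclideanSpace ℝ (Fin n),
      f xp + θ / 2 * ‖xp - x‖ ^ 2 ≤ f z + θ / 2 * ‖z - x‖ ^ 2) :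
    f xp - f xb ≤ (θ / σ) / (1 + θ / σ) * (f x - f xb) := by
  have hb : 0 < σ + θ := by positivity
  -- Compare `xp` with the convex combination of `x` and `xb` whose weights make the
  -- quadratic terms cancel.
  set a := θ / (σ + θ) with ha_def
  set t := σ / (σ + θ) with ht_def
  have hat : a + t = 1 := by rw [ha_def, ht_def]; field_simp; ring
  have hbal : σ * a = θ * t := by rw [ha_def, ht_def]; ring
  have hz := (strongConvexOn_iff_convex.2 hsconv).2 (Set.mem_univ x) (Set.mem_univ xb)
    (by positivity : 0 ≤ a) (by positivity : 0 ≤ t) hat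
  have hstep : a • x + t • xb - x = t • (xb - x) := by
    rw [eq_sub_of_add_eq hat]; module
  have hprox := hmin (a • x + t • xb)
  rw [hstep, norm_smul, Real.norm_of_nonneg (by positivity : 0 ≤ t), norm_sub_rev xb x] at hprox
  have hα : θ / σ / (1 + θ / σ) = a := by rw [ha_def]; field_simp
  have hcancel : a * t * (σ / 2 * ‖x - xb‖ ^ 2) = θ / 2 * (t * ‖x - xb‖) ^ 2 := by
    linear_combination t / 2 * ‖x - xb‖ ^ 2 * hbal
  have hnonneg : 0 ≤ θ / 2 * ‖xp - x‖ ^ 2 := by positivity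
  have hsplit : t * f xb = f xb - a * f xb := by linear_combination f xb * hat
  simp only [smul_eq_mul] at hz
  rw [hα, mul_sub]
  linarith
end

section
/- Let f : ℝⁿ → ℝ be convex and differentiable, let θ > 0 and ρ > 0, and let x̄ be a global minimizer of f with |x̄_i| ≤ ρ for every i. Let (x^t)_{t≥0} be a sequence in ℝⁿ such that for every t, x^{t+1} is a global minimizer of z ↦ f(z) + (θ/2)‖z − x^t‖₂² over ℝⁿ, and |x^t_i| ≤ ρ for every i and every t. Set ν = 2θρ√n. Then for every t ≥ 1, f(x^t) − f(x̄) ≤ max(4ν²/θ, √(2ν²·(f(x⁰) − f(x̄))/θ)) / t. -/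
/-- A real number dominated by arbitrarily small multiples of a fixed number is nonpositive. -/
lemma nonpos_of_forall_le_mul {a b : ℝ} (h : ∀ s : ℝ, 0 < s → s ≤ 1 → a ≤ s * b) : a ≤ 0 := by
  by_contra! ha
  have hab : a ≤ b := by simpa using h 1 one_pos le_rfl
  have hb : 0 < b := ha.trans_le hab
  have hs := h (a / (2 * b)) (by positivity) (by rw [div_le_one (by positivity)]; linarith)
  have : a / (2 * b) * b = a / 2 := by field_simp
  linarith

/-- The three-point inequality for a proximal step of a convex function. -/
lemma ConvexOn.prox_three_point {E : Type*} [NormedAddCommGroup E] [InnerProductSpace ℝ E]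
    {f : E → ℝ} (hf : ConvexOn ℝ Set.univ f) {θ : ℝ} {x p : E}
    (hp : ∀ z, f p + θ / 2 * ‖p - x‖ ^ 2 ≤ f z + θ / 2 * ‖z - x‖ ^ 2) (y : E) :
    f p + θ / 2 * ‖p - x‖ ^ 2 + θ / 2 * ‖p - y‖ ^ 2 ≤ f y + θ / 2 * ‖x - y‖ ^ 2 := by
  have hxy : ‖x - y‖ ^ 2 = ‖p - x‖ ^ 2 + 2 * inner ℝ (p - x) (y - p) + ‖p - y‖ ^ 2 := by
    rw [norm_sub_rev x y, norm_sub_rev p y, ← norm_add_sq_real]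
    congr 2
    abel
  have key : f p - f y - θ * inner ℝ (p - x) (y - p) ≤ 0 := by
    refine nonpos_of_forall_le_mul (b := θ / 2 * ‖y - p‖ ^ 2) fun s hs hs1 => ?_
    have hc := hf.2 (Set.mem_univ p) (Set.mem_univ y) (sub_nonneg.2 hs1) hs.le (by ring)
    have hz := hp ((1 - s) • p + s • y)
    have hn : ‖(1 - s) • p + s • y - x‖ ^ 2
        = ‖p - x‖ ^ 2 + 2 * (s * inner ℝ (p - x) (y - p)) + s ^ 2 * ‖y - p‖ ^ 2 := by
      have : (1 - s) • p + s • y - x = (p - x) + s • (y - p) := by module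
      rw [this, norm_add_sq_real, inner_smul_right, norm_smul, mul_pow, Real.norm_eq_abs, sq_abs]
    rw [hn] at hz
    simp only [smul_eq_mul] at hc
    refine le_of_mul_le_mul_left ?_ hs
    linarith
  rw [hxy]
  linarith

/-- The `O(1/t)` rate of the proximal point iteration. -/
lemma ConvexOn.prox_iterate_rate {E : Type*} [NormedAddCommGroup E] [InnerProductSpace ℝ E]
    {f : E → ℝ} (hf : ConvexOn ℝ Set.univ f) {θ : ℝ} (hθ : 0 ≤ θ) {x : ℕ → E}
    (hstep : ∀ t z, f (x (t + 1)) + θ / 2 * ‖x (t + 1) - x t‖ ^ 2 ≤ f z + θ / 2 * ‖z - x t‖ ^ 2)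
    (y : E) (t : ℕ) :
    t * (f (x t) - f y) + θ / 2 * ‖x t - y‖ ^ 2 ≤ θ / 2 * ‖x 0 - y‖ ^ 2 := by
  induction t with
  | zero => simp
  | succ t ih =>
    have h3 := hf.prox_three_point (hstep t) y
    have hq : 0 ≤ θ / 2 * ‖x (t + 1) - x t‖ ^ 2 := by positivity
    have hmono : f (x (t + 1)) ≤ f (x t) := by
      have h := hstep t (x t)
      simp only [sub_self, norm_zero] at h
      linarith
    have hmul := mul_le_mul_of_nonneg_left hmono (Nat.cast_nonneg (α := ℝ) t)
    push_cast
    linarith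

/-- The Euclidean diameter bound for the cube of half-side `ρ`. -/
lemma EuclideanSpace.norm_sub_sq_le_of_abs_le {ι : Type*} [Fintype ι] {x y : EuclideanSpace ℝ ι}
    {ρ : ℝ} (hx : ∀ i, |x i| ≤ ρ) (hy : ∀ i, |y i| ≤ ρ) :
    ‖x - y‖ ^ 2 ≤ Fintype.card ι * (2 * ρ) ^ 2 := by
  rw [EuclideanSpace.norm_sq_eq, ← nsmul_eq_mul, ← Finset.card_univ]
  refine Finset.sum_le_card_nsmul _ _ _ fun i _ => ?_
  refine pow_le_pow_left₀ (norm_nonneg _) ?_ 2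
  rw [PiLp.sub_apply, Real.norm_eq_abs]
  linarith [abs_sub (x i) (y i), hx i, hy i]


/-- Sublinear `O(1/t)` convergence rate of the proximal point iteration for convex
objectives with bounded iterates (Theorem 2(b) with working set of all `n`
coordinates): with `ν = 2θρ√n`, for every `t ≥ 1`,
`f(xᵗ) − f(x̄) ≤ max(4ν²/θ, √(2ν²(f(x⁰) − f(x̄))/θ)) / t`. -/
theorem prox_sublinear_rate {n : ℕ} (f : EuclideanSpace ℝ (Fin n) → ℝ)
    (hconv : ConvexOn ℝ Set.univ f) (hdiff : Differentiable ℝ f)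
    (θ ρ : ℝ) (hθ : 0 < θ) (hρ : 0 < ρ)
    (xb : EuclideanSpace ℝ (Fin n)) (hxb : ∀ y, f xb ≤ f y)
    (hxbbd : ∀ i, |xb i| ≤ ρ)
    (x : ℕ → EuclideanSpace ℝ (Fin n))
    (hstep : ∀ t : ℕ, ∀ z : EuclideanSpace ℝ (Fin n),
      f (x (t + 1)) + θ / 2 * ‖x (t + 1) - x t‖ ^ 2 ≤ f z + θ / 2 * ‖z - x t‖ ^ 2)
    (hbd : ∀ t : ℕ, ∀ i, |x t i| ≤ ρ) :
    ∀ t : ℕ, 1 ≤ t →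
      f (x t) - f xb ≤
        max (4 * (2 * θ * ρ * Real.sqrt n) ^ 2 / θ)
          (Real.sqrt (2 * (2 * θ * ρ * Real.sqrt n) ^ 2 * (f (x 0) - f xb) / θ)) / t := by
  intro t ht
  have ht0 : (0 : ℝ) < t := by exact_mod_cast ht
  have hrate := hconv.prox_iterate_rate hθ.le hstep xb t
  have hdiam := EuclideanSpace.norm_sub_sq_le_of_abs_le (hbd 0) hxbbd
  rw [Fintype.card_fin] at hdiam
  have hν : 4 * (2 * θ * ρ * Real.sqrt n) ^ 2 / θ = 4 * θ * (n * (2 * ρ) ^ 2) := by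
    rw [mul_pow, Real.sq_sqrt n.cast_nonneg]
    field_simp
  rw [le_div_iff₀ ht0]
  refine le_max_of_le_left ?_
  rw [hν]
  have h1 := mul_le_mul_of_nonneg_left hdiam hθ.le
  have h2 : 0 ≤ θ * ‖x t - xb‖ ^ 2 := by positivity
  have h3 : 0 ≤ θ * (n * (2 * ρ) ^ 2) := by positivity
  linarith
end
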